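/- arXiv:1810.05389 — 3 statements merged into one kernel-verified Lean document; each statement's English description precedes it below -/
import Mathlib

section
/- Let Q ≥ 1 and let A be a Q×Q complex matrix that is Hermitian and positive definite. Then for every unitary matrix Υ ∈ Matrix.unitaryGroup (Fin Q) ℂ, writing γ_q for the q-th column of Υ, one has ∑_{q=0}^{Q-1} 1/Re(γ_qᴴ A γ_q) ≤ Re(trace(A⁻¹)). (Here each quadratic form γ_qᴴ A γ_q is a positive real number since A is positive definite and γ_q is a unit vector.) -/
open Matrix ComplexOrder

/-- A diagonal entry of the inverse of a positive definite matrix is at least the inverse of the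
corresponding diagonal entry of the matrix. -/
theorem Matrix.PosDef.one_div_re_diag_le_re_inv_diag {n : Type*} [Fintype n] [DecidableEq n]
    {B : Matrix n n ℂ} (hB : B.PosDef) (q : n) : 1 / (B q q).re ≤ (B⁻¹ q q).re := by
  have hpos : 0 < (B q q).re := (Complex.pos_iff.mp hB.diag_pos).1
  have hdet : IsUnit B.det := (Matrix.isUnit_iff_isUnit_det B).mp hB.isUnit
  set t : ℝ := 1 / (B q q).re with ht
  have hC : (B⁻¹ - (t : ℂ) • (1 : Matrix n n ℂ))ᴴ = B⁻¹ - (t : ℂ) • 1 := by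
    rw [conjTranspose_sub, hB.inv.isHermitian.eq, conjTranspose_smul, conjTranspose_one,
      Complex.star_def, Complex.conj_ofReal]
  have hexp : (B⁻¹ - (t : ℂ) • (1 : Matrix n n ℂ)) * B * (B⁻¹ - (t : ℂ) • 1) =
      B⁻¹ - (t : ℂ) • 1 - (t : ℂ) • 1 + (t : ℂ) • (t : ℂ) • B := by
    simp only [sub_mul, mul_sub, smul_mul_assoc, mul_smul_comm, smul_sub, one_mul, mul_one,
      nonsing_inv_mul B hdet, mul_nonsing_inv B hdet]
    abel
  have h := (hB.posSemidef.conjTranspose_mul_mul_same (B⁻¹ - (t : ℂ) • 1)).diag_nonneg (i := q)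
  rw [hC, hexp] at h
  have h' := (Complex.nonneg_iff.mp h).1
  simp only [add_apply, sub_apply, smul_apply, one_apply_eq, smul_eq_mul, mul_one,
    Complex.add_re, Complex.sub_re, Complex.re_ofReal_mul, Complex.ofReal_re] at h'
  have htB : t * (B q q).re = 1 := one_div_mul_cancel hpos.ne'
  rw [htB, mul_one] at h'
  linarith

/-- Lemma 1 of the paper (inequality part): for a Hermitian positive definite
`Q × Q` complex matrix `A` and any unitary matrix `Υ` with columns `γ_q`,
`∑ q, 1 / Re(γ_qᴴ A γ_q) ≤ Re(trace A⁻¹)`. -/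
theorem adaf_lemma1_ineq {Q : ℕ} (hQ : 1 ≤ Q) (A : Matrix (Fin Q) (Fin Q) ℂ)
    (hA : A.IsHermitian) (hApd : A.PosDef)
    (Υ : Matrix (Fin Q) (Fin Q) ℂ) (hΥ : Υ ∈ Matrix.unitaryGroup (Fin Q) ℂ) :
    ∑ q : Fin Q, 1 / (star (fun i => Υ i q) ⬝ᵥ A.mulVec fun i => Υ i q).re ≤
      (A⁻¹.trace).re := by
  have h₁ : Υ * Υᴴ = 1 := mem_unitaryGroup_iff.mp hΥ
  have h₂ : Υᴴ * Υ = 1 := mem_unitaryGroup_iff'.mp hΥ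
  have hB : (Υᴴ * A * Υ).PosDef := by
    have hU : IsUnit Υ := IsUnit.of_mul_eq_one _ h₁
    exact (Matrix.IsUnit.posDef_star_left_conjugate_iff hU).mpr hApd
  have hinv : (Υᴴ * A * Υ)⁻¹ = Υᴴ * A⁻¹ * Υ := by
    rw [Matrix.mul_inv_rev, Matrix.mul_inv_rev, inv_eq_right_inv h₁, inv_eq_right_inv h₂, mul_assoc]
  have htr : A⁻¹.trace = (Υᴴ * A * Υ)⁻¹.trace := by
    rw [hinv, trace_mul_comm, ← mul_assoc, h₁, one_mul]
  have hentry (q : Fin Q) :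
      star (fun i => Υ i q) ⬝ᵥ A.mulVec (fun i => Υ i q) = (Υᴴ * A * Υ) q q := by
    rw [mul_assoc]
    rfl
  rw [htr, trace, Complex.re_sum]
  refine Finset.sum_le_sum fun q _ => ?_
  rw [hentry]
  exact hB.one_div_re_diag_le_re_inv_diag q
end

section
/- Let Q ≥ 1, let A be a Q×Q complex Hermitian positive definite matrix, and let Υ be a unitary Q×Q complex matrix whose columns γ_q are eigenvectors of A, i.e. A.mulVec γ_q = λ_q • γ_q for positive real numbers λ_q (q = 0,…,Q−1). Then ∑_{q=0}^{Q-1} 1/Re(γ_qᴴ A γ_q) = ∑_{q=0}^{Q-1} 1/λ_q = Re(trace(A⁻¹)). In other words, the value tr(A⁻¹) in Lemma 1 is attained when the filtering vectors are taken to be an orthonormal eigenbasis of A. -/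
open Matrix ComplexOrder

namespace Matrix

variable {n : Type*} [Fintype n] [DecidableEq n]

/-- The inverse of a matrix that is diagonalized by a unitary matrix `U` with nonzero
eigenvalues `d`. -/
theorem inv_eq_of_mul_unitary_eq_mul_diagonal {A U : Matrix n n ℂ} (hU : U ∈ unitaryGroup n ℂ)
    {d : n → ℂ} (hd : ∀ i, d i ≠ 0) (h : A * U = U * diagonal d) :
    A⁻¹ = U * diagonal d⁻¹ * star U := by
  have hdd : diagonal d * diagonal d⁻¹ = 1 := by
    simp [diagonal_mul_diagonal, hd]
  refine inv_eq_right_inv ?_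
  rw [← mul_assoc, ← mul_assoc, h, mul_assoc U, hdd, mul_one, mem_unitaryGroup_iff.mp hU]

theorem trace_inv_of_mul_unitary_eq_mul_diagonal {A U : Matrix n n ℂ} (hU : U ∈ unitaryGroup n ℂ)
    {d : n → ℂ} (hd : ∀ i, d i ≠ 0) (h : A * U = U * diagonal d) :
    A⁻¹.trace = ∑ i, (d i)⁻¹ := by
  rw [inv_eq_of_mul_unitary_eq_mul_diagonal hU hd h, trace_mul_comm, ← mul_assoc,
    mem_unitaryGroup_iff'.mp hU, one_mul, trace_diagonal]
  rfl

/-- The columns of a unitary matrix are unit vectors. -/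
theorem star_col_dotProduct_col_of_mem_unitaryGroup {U : Matrix n n ℂ} (hU : U ∈ unitaryGroup n ℂ)
    (q : n) : (star fun i => U i q) ⬝ᵥ (fun i => U i q) = 1 := by
  simpa [mul_apply, dotProduct] using congr_fun₂ (mem_unitaryGroup_iff'.mp hU) q q

end Matrix

/-- Lemma 1 of the paper (attainment part): if the columns `γ_q` of the unitary
matrix `Υ` are eigenvectors of the Hermitian positive definite matrix `A` with
positive eigenvalues `lam q`, then `∑ q, 1 / Re(γ_qᴴ A γ_q) = ∑ q, 1 / lam q
= Re(trace A⁻¹)`. -/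
theorem adaf_lemma1_attained {Q : ℕ} (hQ : 1 ≤ Q) (A : Matrix (Fin Q) (Fin Q) ℂ)
    (hA : A.IsHermitian) (hApd : A.PosDef)
    (Υ : Matrix (Fin Q) (Fin Q) ℂ) (hΥ : Υ ∈ Matrix.unitaryGroup (Fin Q) ℂ)
    (lam : Fin Q → ℝ) (hlam : ∀ q, 0 < lam q)
    (heig : ∀ q, A.mulVec (fun i => Υ i q) = (lam q : ℂ) • fun i => Υ i q) :
    (∑ q : Fin Q, 1 / (star (fun i => Υ i q) ⬝ᵥ A.mulVec fun i => Υ i q).re =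
        ∑ q : Fin Q, 1 / lam q) ∧
      ∑ q : Fin Q, 1 / lam q = (A⁻¹.trace).re := by
  constructor
  · refine Finset.sum_congr rfl fun q _ => ?_
    rw [heig q, dotProduct_smul, star_col_dotProduct_col_of_mem_unitaryGroup hΥ]
    simp
  · have h : A * Υ = Υ * diagonal fun q => (lam q : ℂ) := by
      ext i q
      rw [mul_diagonal, mul_comm]
      exact congr_fun (heig q) i
    have hne : ∀ q, (lam q : ℂ) ≠ 0 := fun q => Complex.ofReal_ne_zero.mpr (hlam q).ne'
    rw [trace_inv_of_mul_unitary_eq_mul_diagonal hΥ hne h, Complex.re_sum]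
    simp only [one_div, ← Complex.ofReal_inv, Complex.ofReal_re]
end

section
/- Let (Ω, μ) be a probability space and let N : Ω → Matrix (Fin n) (Fin m) ℂ be a random matrix whose entries satisfy: each product N_{ij}·conj(N_{kl}) is integrable, and E[N_{ij}·conj(N_{kl})] = σ² if (i,j) = (k,l) and 0 otherwise, for a fixed real σ² ≥ 0. Then for any fixed deterministic matrices A ∈ Matrix (Fin R) (Fin n) ℂ and C ∈ Matrix (Fin m) (Fin R) ℂ, E[ trace(A·N·C) · trace(Cᴴ·Nᴴ·Aᴴ) ] = σ² · trace(A·Aᴴ·Cᴴ·C). Equivalently, E[ |trace(A·N·C)|² ] = σ² · trace(A·Aᴴ·Cᴴ·C). -/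
open Matrix MeasureTheory

theorem Matrix.trace_mul_mul_eq_sum_prod {ι κ ρ α : Type*} [Fintype ι] [Fintype κ] [Fintype ρ]
    [CommSemiring α] (A : Matrix ρ ι α) (X : Matrix ι κ α) (C : Matrix κ ρ α) :
    (A * X * C).trace = ∑ p : ι × κ, X p.1 p.2 * (C * A) p.2 p.1 := by
  rw [Matrix.mul_assoc, Matrix.trace_mul_comm, Matrix.mul_assoc, Fintype.sum_prod_type]
  simp only [Matrix.trace, Matrix.diag_apply, Matrix.mul_apply (M := X)]

theorem Matrix.trace_mul_conjTranspose_self_eq_sum_prod {ι κ α : Type*} [Fintype ι] [Fintype κ]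
    [CommSemiring α] [StarRing α] (B : Matrix κ ι α) :
    (B * Bᴴ).trace = ∑ p : ι × κ, B p.2 p.1 * star (B p.2 p.1) := by
  rw [Fintype.sum_prod_type_right]
  simp only [Matrix.trace, Matrix.diag_apply, Matrix.mul_apply, Matrix.conjTranspose_apply]

/-- Lemma 2 of the paper (exact expectation form): if the entries of the random
matrix `N` are zero-mean and uncorrelated with common variance `σ²`, i.e.
`E[N_{ij} conj (N_{kl})] = σ²` when `(i,j) = (k,l)` and `0` otherwise, then for
fixed matrices `A` and `C`,
`E[trace (A N C) * trace (Cᴴ Nᴴ Aᴴ)] = σ² * trace (A Aᴴ Cᴴ C)`. -/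
theorem expectation_trace_ANC_mul_trace_conj {n m R : ℕ} {Ω : Type*}
    [MeasurableSpace Ω] (μ : Measure Ω) [IsProbabilityMeasure μ]
    (N : Ω → Matrix (Fin n) (Fin m) ℂ) (σ2 : ℝ) (hσ2 : 0 ≤ σ2)
    (hint : ∀ i j k l, Integrable (fun ω => N ω i j * (starRingEnd ℂ) (N ω k l)) μ)
    (hcov : ∀ i j k l, ∫ ω, N ω i j * (starRingEnd ℂ) (N ω k l) ∂μ =
      if i = k ∧ j = l then (σ2 : ℂ) else 0)
    (A : Matrix (Fin R) (Fin n) ℂ) (C : Matrix (Fin m) (Fin R) ℂ) :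
    ∫ ω, (A * N ω * C).trace * (Cᴴ * (N ω)ᴴ * Aᴴ).trace ∂μ =
      (σ2 : ℂ) * (A * Aᴴ * Cᴴ * C).trace := by
  have hconj (ω : Ω) : (Cᴴ * (N ω)ᴴ * Aᴴ).trace = star (A * N ω * C).trace := by
    rw [← trace_conjTranspose, conjTranspose_mul, conjTranspose_mul, Matrix.mul_assoc]
  have hexpand (ω : Ω) : (A * N ω * C).trace * (Cᴴ * (N ω)ᴴ * Aᴴ).trace =
      ∑ p : Fin n × Fin m, ∑ q : Fin n × Fin m,
        ((C * A) p.2 p.1 * star ((C * A) q.2 q.1)) *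
          (N ω p.1 p.2 * (starRingEnd ℂ) (N ω q.1 q.2)) := by
    rw [hconj, trace_mul_mul_eq_sum_prod, star_sum, Finset.sum_mul_sum]
    refine Finset.sum_congr rfl fun p _ => Finset.sum_congr rfl fun q _ => ?_
    rw [star_mul', starRingEnd_apply]
    ring
  have htrace : (A * Aᴴ * Cᴴ * C).trace = ((C * A) * (C * A)ᴴ).trace := by
    rw [trace_mul_comm, conjTranspose_mul]
    simp only [Matrix.mul_assoc]
  have hint' (p q : Fin n × Fin m) := (hint p.1 p.2 q.1 q.2).const_mul
    ((C * A) p.2 p.1 * star ((C * A) q.2 q.1))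
  simp_rw [hexpand]
  rw [integral_finsetSum _ fun p _ => integrable_finsetSum _ fun q _ => hint' p q,
    htrace, trace_mul_conjTranspose_self_eq_sum_prod, Finset.mul_sum]
  refine Finset.sum_congr rfl fun p _ => ?_
  rw [integral_finsetSum _ fun q _ => hint' p q]
  simp_rw [integral_const_mul, hcov, ← Prod.ext_iff]
  rw [Finset.sum_congr rfl fun q _ => mul_ite _ _ _ _]
  simp [mul_comm]
end
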